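/- Fix a real number α ∈ [0,1], and for each n ≥ 2 let Ψₙ(α) denote the maximum of αλ₁(T) + (1-α)λ₂(T) over all trees T on n vertices. Then the limit as n → ∞ of Ψₙ(α)/√(n-1) equals √(1/2) if α ≤ 1/2, and equals √(α² + (1-α)²) if α > 1/2. -/

import Mathlib

open scoped Classical

/-- Adjacency matrix of a simple graph on `Fin n`, over `ℝ`. -/
noncomputable def adjMat {n : ℕ} (G : SimpleGraph (Fin n)) : Matrix (Fin n) (Fin n) ℝ :=
  fun i j => if G.Adj i j then 1 else 0

/-- The eigenvalues (roots of the characteristic polynomial, with multiplicity)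
of the adjacency matrix, sorted in nondecreasing order. -/
noncomputable def eigList {n : ℕ} (G : SimpleGraph (Fin n)) : List ℝ :=
  (Matrix.charpoly (adjMat G)).roots.sort (· ≤ ·)

/-- `lam k G` is the `k`-th largest adjacency eigenvalue of `G` (so `lam 1` is `λ₁`). -/
noncomputable def lam {n : ℕ} (k : ℕ) (G : SimpleGraph (Fin n)) : ℝ :=
  (eigList G).getD (n - k) 0

/-- The double comet `DC(k1, k2, l)`: a path on `l` vertices (the vertices `0, …, l-1`),
with `k1` pendant leaves attached to the terminal vertex `0` and `k2` pendant leaves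
attached to the terminal vertex `l - 1`. -/
def doubleComet (k1 k2 l : ℕ) : SimpleGraph (Fin (k1 + k2 + l)) :=
  SimpleGraph.fromRel (fun i j =>
    ((i : ℕ) + 1 = (j : ℕ) ∧ (j : ℕ) < l) ∨
    (l ≤ (i : ℕ) ∧ (i : ℕ) < l + k1 ∧ (j : ℕ) = 0) ∨
    (l + k1 ≤ (i : ℕ) ∧ (j : ℕ) = l - 1))

/-- Degree of a vertex. -/
noncomputable def deg {n : ℕ} (G : SimpleGraph (Fin n)) (u : Fin n) : ℕ :=
  (Finset.univ.filter (fun w => G.Adj u w)).card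

lemma adjMat_herm {n : ℕ} (G : SimpleGraph (Fin n)) : (adjMat G).IsHermitian := by
  ext i j
  simp [adjMat, Matrix.conjTranspose_apply, G.adj_comm]

lemma eigList_eq {n : ℕ} (G : SimpleGraph (Fin n)) :
    eigList G = (List.ofFn (adjMat_herm G).eigenvalues₀).reverse := by
  have h := (adjMat_herm G).roots_charpoly_eq_eigenvalues₀
  apply List.Perm.eq_of_pairwise' (r := (· ≤ ·))
  · exact Multiset.pairwise_sort _ _
  · rw [List.pairwise_reverse, ← List.sortedGE_iff_pairwise]
    exact (Matrix.IsHermitian.eigenvalues₀_antitone _).sortedGE_ofFn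
  · rw [← Multiset.coe_eq_coe, eigList, Multiset.sort_eq, h, Multiset.coe_reverse,
      Fin.univ_val_map]
    rfl

lemma lam_eq {n : ℕ} (G : SimpleGraph (Fin n)) (k : ℕ) (h1 : 1 ≤ k) (hk : k ≤ n) :
    lam k G = (adjMat_herm G).eigenvalues₀ ⟨k - 1, by rw [Fintype.card_fin]; omega⟩ := by
  rw [lam, eigList_eq, List.getD_eq_getElem _ _ (by simp; omega), List.getElem_reverse,
    List.getElem_ofFn]
  congr 2
  simp
  omega

lemma spec {n : ℕ} (hn : 2 ≤ n) (G : SimpleGraph (Fin n)) :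
    ∃ i0, (∀ i, (adjMat_herm G).eigenvalues i ≤ lam 1 G) ∧
      ∀ i ≠ i0, (adjMat_herm G).eigenvalues i ≤ lam 2 G := by
  set e : Fin (Fintype.card (Fin n)) ≃ Fin n := Fintype.equivOfCardEq (Fintype.card_fin _) with he
  have hc : 2 ≤ Fintype.card (Fin n) := by simpa using hn
  refine ⟨e ⟨0, by omega⟩, fun i => ?_, fun i hi => ?_⟩
  · rw [lam_eq G 1 le_rfl (by omega)]
    apply (adjMat_herm G).eigenvalues₀_antitone
    simp [Fin.le_def]
  · rw [lam_eq G 2 (by omega) (by omega)]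
    apply (adjMat_herm G).eigenvalues₀_antitone
    rw [Fin.le_def]
    have : e.symm i ≠ ⟨0, by omega⟩ := fun h => hi (by rw [← h]; simp)
    have h2 : (e.symm i).val ≠ 0 := fun h => this (Fin.ext h)
    show 1 ≤ (e.symm i).val
    omega

lemma lam2_le_lam1 {n : ℕ} (hn : 2 ≤ n) (G : SimpleGraph (Fin n)) : lam 2 G ≤ lam 1 G := by
  rw [lam_eq G 2 (by omega) (by omega), lam_eq G 1 (by omega) (by omega)]
  apply (adjMat_herm G).eigenvalues₀_antitone
  simp [Fin.le_def]

open Matrix in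
lemma rayleigh {n : ℕ} (A : Matrix (Fin n) (Fin n) ℝ) (hA : A.IsHermitian) (x : Fin n → ℝ) :
    x ⬝ᵥ (A *ᵥ x) = ∑ i, hA.eigenvalues i * (x ⬝ᵥ ⇑(hA.eigenvectorBasis i)) ^ 2 ∧
    x ⬝ᵥ x = ∑ i, (x ⬝ᵥ ⇑(hA.eigenvectorBasis i)) ^ 2 := by
  have key : ∀ y : Fin n → ℝ, x ⬝ᵥ y =
      ∑ i, (x ⬝ᵥ ⇑(hA.eigenvectorBasis i)) * (⇑(hA.eigenvectorBasis i) ⬝ᵥ y) := by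
    intro y
    have := hA.eigenvectorBasis.sum_inner_mul_inner (WithLp.toLp 2 x) (WithLp.toLp 2 y)
    simp only [EuclideanSpace.inner_eq_star_dotProduct, star_trivial] at this
    rw [dotProduct_comm, ← this]
    refine Finset.sum_congr rfl fun i _ => ?_
    rw [dotProduct_comm x, dotProduct_comm y]
  constructor
  · rw [key]
    refine Finset.sum_congr rfl fun i _ => ?_
    have hT : Aᵀ = A := by simpa [Matrix.IsHermitian, conjTranspose_eq_transpose_of_trivial] using hA
    rw [dotProduct_mulVec, ← mulVec_transpose, hT, hA.mulVec_eigenvectorBasis, smul_dotProduct,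
      dotProduct_comm x, smul_eq_mul]
    ring
  · rw [key]
    refine Finset.sum_congr rfl fun i _ => ?_
    rw [dotProduct_comm x]
    ring

open Matrix in
lemma lam1_ge {n : ℕ} (hn : 2 ≤ n) (G : SimpleGraph (Fin n)) (u : Fin n → ℝ) (m : ℝ)
    (h0 : 0 < u ⬝ᵥ u) (hu : m * (u ⬝ᵥ u) ≤ u ⬝ᵥ (adjMat G *ᵥ u)) : m ≤ lam 1 G := by
  obtain ⟨i0, h1, h2⟩ := spec hn G
  obtain ⟨r1, r2⟩ := rayleigh _ (adjMat_herm G) u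
  have : u ⬝ᵥ (adjMat G *ᵥ u) ≤ lam 1 G * (u ⬝ᵥ u) := by
    rw [r1, r2, Finset.mul_sum]
    exact Finset.sum_le_sum fun i _ => mul_le_mul_of_nonneg_right (h1 i) (sq_nonneg _)
  exact le_of_mul_le_mul_right (hu.trans this) h0

open Matrix in
lemma lam2_ge {n : ℕ} (hn : 2 ≤ n) (G : SimpleGraph (Fin n)) (u v : Fin n → ℝ) (m : ℝ)
    (hu0 : 0 < u ⬝ᵥ u) (hv0 : 0 < v ⬝ᵥ v) (huv : u ⬝ᵥ v = 0)
    (hAuv : u ⬝ᵥ (adjMat G *ᵥ v) = 0) (hAvu : v ⬝ᵥ (adjMat G *ᵥ u) = 0)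
    (hu : m * (u ⬝ᵥ u) ≤ u ⬝ᵥ (adjMat G *ᵥ u))
    (hv : m * (v ⬝ᵥ v) ≤ v ⬝ᵥ (adjMat G *ᵥ v)) : m ≤ lam 2 G := by
  obtain ⟨i0, h1, h2⟩ := spec hn G
  set b : Fin n → ℝ := ⇑((adjMat_herm G).eigenvectorBasis i0) with hb
  obtain ⟨p, q, hpq, hne⟩ : ∃ p q : ℝ, p * (u ⬝ᵥ b) + q * (v ⬝ᵥ b) = 0 ∧ 0 < p ^ 2 + q ^ 2 := by
    by_cases h : u ⬝ᵥ b = 0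
    · exact ⟨1, 0, by simp [h], by norm_num⟩
    · exact ⟨v ⬝ᵥ b, -(u ⬝ᵥ b), by ring, by have := pow_pos (abs_pos.mpr h) 2; rw [sq_abs] at this; nlinarith [sq_nonneg (v ⬝ᵥ b)]⟩
  obtain ⟨r1, r2⟩ := rayleigh _ (adjMat_herm G) (p • u + q • v)
  have hxb : (p • u + q • v) ⬝ᵥ b = 0 := by
    simp [add_dotProduct, smul_dotProduct, hpq]
  have hle : (p • u + q • v) ⬝ᵥ (adjMat G *ᵥ (p • u + q • v)) ≤
      lam 2 G * ((p • u + q • v) ⬝ᵥ (p • u + q • v)) := by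
    rw [r1, r2, Finset.mul_sum]
    refine Finset.sum_le_sum fun i _ => ?_
    by_cases hi : i = i0
    · rw [hi, ← hb, hxb]; simp
    · exact mul_le_mul_of_nonneg_right (h2 i hi) (sq_nonneg _)
  have e1 : (p • u + q • v) ⬝ᵥ (p • u + q • v) = p ^ 2 * (u ⬝ᵥ u) + q ^ 2 * (v ⬝ᵥ v) := by
    have huv' : v ⬝ᵥ u = 0 := by rw [dotProduct_comm, huv]
    simp [add_dotProduct, dotProduct_add, smul_dotProduct, dotProduct_smul, huv, huv']
    ring
  have e2 : (p • u + q • v) ⬝ᵥ (adjMat G *ᵥ (p • u + q • v)) =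
      p ^ 2 * (u ⬝ᵥ (adjMat G *ᵥ u)) + q ^ 2 * (v ⬝ᵥ (adjMat G *ᵥ v)) := by
    simp [mulVec_add, mulVec_smul, add_dotProduct, dotProduct_add, smul_dotProduct,
      dotProduct_smul, hAuv, hAvu]
    ring
  rw [e1, e2] at hle
  have hpos : 0 < p ^ 2 * (u ⬝ᵥ u) + q ^ 2 * (v ⬝ᵥ v) := by
    by_contra hcon
    have a1 : 0 ≤ p ^ 2 * (u ⬝ᵥ u) := by positivity
    have a2 : 0 ≤ q ^ 2 * (v ⬝ᵥ v) := by positivity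
    have a3 : p ^ 2 * (u ⬝ᵥ u) = 0 := by linarith
    have a4 : q ^ 2 * (v ⬝ᵥ v) = 0 := by linarith
    have a5 : p ^ 2 = 0 := (mul_eq_zero.mp a3).resolve_right hu0.ne'
    have a6 : q ^ 2 = 0 := (mul_eq_zero.mp a4).resolve_right hv0.ne'
    linarith
  refine le_of_mul_le_mul_right (le_trans ?_ hle) hpos
  nlinarith [mul_le_mul_of_nonneg_left hu (sq_nonneg p), mul_le_mul_of_nonneg_left hv (sq_nonneg q)]

lemma roots_aux {n : ℕ} (f : Fin n → ℝ) :
    (∏ i, (Polynomial.X - Polynomial.C (f i))).roots = Finset.univ.val.map f := by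
  have := Polynomial.roots_multiset_prod_X_sub_C (Finset.univ.val.map f)
  rwa [Multiset.map_map] at this

lemma sum_sq {n : ℕ} (G : SimpleGraph (Fin n)) (hG : G.IsTree) :
    ∑ i, ((adjMat_herm G).eigenvalues₀ i) ^ 2 = 2 * ((n : ℝ) - 1) := by
  have hA := adjMat_herm G
  have h1 : cfc (fun x : ℝ => x ^ 2) (adjMat G) = adjMat G ^ 2 :=
    cfc_pow_id (R := ℝ) (adjMat G) 2 hA
  have h2 := hA.charpoly_cfc_eq (fun x => x ^ 2)
  rw [h1] at h2
  have h3 : (adjMat G ^ 2).trace = ∑ i, (hA.eigenvalues i) ^ 2 := by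
    rw [Matrix.trace_eq_sum_roots_charpoly_of_splits, h2, roots_aux]
    · rfl
    · rw [h2]
      exact Polynomial.Splits.prod fun i _ => Polynomial.Splits.X_sub_C _
  have h4 : ∑ i, (hA.eigenvalues i) ^ 2 = ∑ i, ((adjMat_herm G).eigenvalues₀ i) ^ 2 :=
    Equiv.sum_comp (Fintype.equivOfCardEq (Fintype.card_fin _)).symm
      (fun i => ((adjMat_herm G).eigenvalues₀ i) ^ 2)
  have h5 : (adjMat G ^ 2).trace = ((∑ v, G.degree v : ℕ) : ℝ) := by
    rw [pow_two, Matrix.trace]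
    push_cast
    refine Finset.sum_congr rfl fun i _ => ?_
    rw [Matrix.diag_apply, Matrix.mul_apply]
    have : ∀ j, adjMat G i j * adjMat G j i = if G.Adj i j then 1 else 0 := by
      intro j
      simp only [adjMat, G.adj_comm j i]
      split_ifs <;> simp
    simp only [this, Finset.sum_boole]
    rw [← SimpleGraph.card_neighborFinset_eq_degree, SimpleGraph.neighborFinset_eq_filter]
  rw [← h4, ← h3, h5, SimpleGraph.sum_degrees_eq_twice_card_edges]
  have := hG.card_edgeFinset
  rw [Fintype.card_fin] at this
  have h6 : ((G.edgeFinset.card : ℝ)) + 1 = n := by exact_mod_cast this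
  push_cast
  linarith

lemma neg_symm {n : ℕ} (G : SimpleGraph (Fin n)) (hG : G.IsTree) :
    (adjMat G).charpoly.roots.map (fun x => -x) = (adjMat G).charpoly.roots := by
  have hA := adjMat_herm G
  have h1 : cfc (fun x : ℝ => -x) (adjMat G) = -adjMat G := cfc_neg_id (R := ℝ) (adjMat G) hA
  have h2 := hA.charpoly_cfc_eq (fun x => -x)
  rw [h1] at h2
  have c := hG.coloringTwo
  let D : Matrix (Fin n) (Fin n) ℝ := Matrix.diagonal fun i => if c i = 0 then 1 else -1
  have hD : D * D = 1 := by
    simp only [D, Matrix.diagonal_mul_diagonal]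
    rw [← Matrix.diagonal_one]
    congr 1
    ext i
    split_ifs <;> norm_num
  have h3 : D * adjMat G * D = - adjMat G := by
    ext i j
    simp only [D, Matrix.mul_diagonal, Matrix.diagonal_mul, Matrix.neg_apply, adjMat]
    by_cases h : G.Adj i j
    · have := c.valid h
      have f2 : ∀ a : Fin 2, a = 0 ∨ a = 1 := by decide
      rcases f2 (c i) with hi | hi <;> rcases f2 (c j) with hj | hj <;> simp_all
    · simp [h]
  have h4 : (-adjMat G).charpoly = (adjMat G).charpoly := by
    rw [← h3, Matrix.charpoly_mul_comm, ← mul_assoc, hD, one_mul]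
  rw [h4] at h2
  conv_rhs => rw [h2, roots_aux]
  rw [hA.roots_charpoly_eq_eigenvalues, Multiset.map_map]
  rfl

lemma eigList_symm {n : ℕ} (G : SimpleGraph (Fin n)) (hG : G.IsTree) :
    eigList G = ((eigList G).map (fun x => -x)).reverse := by
  apply List.Perm.eq_of_pairwise' (r := (· ≤ ·))
  · exact Multiset.pairwise_sort _ _
  · rw [List.pairwise_reverse, List.pairwise_map]
    refine (Multiset.pairwise_sort _ _).imp ?_
    intro a b h
    simpa using h
  · rw [← Multiset.coe_eq_coe, Multiset.coe_reverse, ← Multiset.map_coe, eigList,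
      Multiset.sort_eq, neg_symm G hG]

lemma sq_add_sq_le {n : ℕ} (hn : 4 ≤ n) (G : SimpleGraph (Fin n)) (hG : G.IsTree) :
    lam 1 G ^ 2 + lam 2 G ^ 2 ≤ (n : ℝ) - 1 := by
  have hlen : (eigList G).length = n := by rw [eigList_eq]; simp
  have key : ∀ k, 1 ≤ k → k ≤ n → lam (n + 1 - k) G = - lam k G := by
    intro k h1 h2
    unfold lam
    conv_lhs => rw [eigList_symm G hG]
    rw [List.getD_eq_getElem _ _ (by simp; omega), List.getD_eq_getElem _ _ (by omega)]
    simp only [List.getElem_reverse, List.getElem_map, List.length_map, hlen]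
    congr 2
    omega
  have k1 := key 1 le_rfl (by omega)
  have k2 := key 2 (by omega) (by omega)
  have hs := sum_sq G hG
  rw [lam_eq G _ (by omega) (by omega), lam_eq G _ (by omega) (by omega)] at k1 k2
  rw [lam_eq G _ (by omega) (by omega), lam_eq G _ (by omega) (by omega)]
  set l := (adjMat_herm G).eigenvalues₀
  have hc : Fintype.card (Fin n) = n := Fintype.card_fin n
  let s : Finset (Fin (Fintype.card (Fin n))) :=
    {⟨1 - 1, by omega⟩, ⟨2 - 1, by omega⟩, ⟨n + 1 - 1 - 1, by omega⟩, ⟨n + 1 - 2 - 1, by omega⟩}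
  have h1 : ∑ i ∈ s, l i ^ 2 ≤ ∑ i, l i ^ 2 :=
    Finset.sum_le_sum_of_subset_of_nonneg (Finset.subset_univ _) fun i _ _ => sq_nonneg _
  rw [hs] at h1
  rw [Finset.sum_insert (by simp [Fin.ext_iff]; omega), Finset.sum_insert (by simp [Fin.ext_iff]; omega),
    Finset.sum_insert (by simp [Fin.ext_iff]; omega), Finset.sum_singleton, k1, k2] at h1
  nlinarith
noncomputable def starVec {n : ℕ} (c : Fin n) (S : Finset (Fin n)) (t : ℝ) : Fin n → ℝ :=
  fun i => (if i = c then 1 else 0) + (if i ∈ S then t else 0)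

open Matrix in
lemma starVec_dot {n : ℕ} (c : Fin n) (S : Finset (Fin n)) (t : ℝ) (g : Fin n → ℝ) :
    starVec c S t ⬝ᵥ g = g c + t * ∑ s ∈ S, g s := by
  simp [starVec, dotProduct, add_mul, Finset.sum_add_distrib, ite_mul, Finset.mul_sum,
    Finset.sum_ite_mem]

open Matrix in
lemma mulVec_starVec {n : ℕ} (A : Matrix (Fin n) (Fin n) ℝ) (c : Fin n) (S : Finset (Fin n))
    (t : ℝ) (i : Fin n) :
    (A *ᵥ starVec c S t) i = A i c + t * ∑ s ∈ S, A i s := by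
  rw [mulVec, dotProduct_comm, starVec_dot]

open Matrix in
lemma star_cross {n : ℕ} (G : SimpleGraph (Fin n)) (c c' : Fin n) (S S' : Finset (Fin n))
    (t t' : ℝ) (h1 : ¬ G.Adj c c') (h2 : ∀ s ∈ S', ¬ G.Adj c s) (h3 : ∀ s ∈ S, ¬ G.Adj s c')
    (h4 : ∀ s ∈ S, ∀ s' ∈ S', ¬ G.Adj s s') :
    starVec c S t ⬝ᵥ (adjMat G *ᵥ starVec c' S' t') = 0 := by
  rw [starVec_dot]
  simp only [mulVec_starVec]
  have e2 : ∑ s ∈ S', adjMat G c s = 0 := Finset.sum_eq_zero fun s hs => by simp [adjMat, h2 s hs]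
  have e3 : ∑ s ∈ S, (adjMat G s c' + t' * ∑ s' ∈ S', adjMat G s s') = 0 := by
    refine Finset.sum_eq_zero fun s hs => ?_
    have : ∑ s' ∈ S', adjMat G s s' = 0 :=
      Finset.sum_eq_zero fun s' hs' => by simp [adjMat, h4 s hs s' hs']
    rw [this]; simp [adjMat, h3 s hs]
  rw [e2, e3]
  simp [adjMat, h1]

open Matrix in
lemma star_orth {n : ℕ} (c c' : Fin n) (S S' : Finset (Fin n))
    (t t' : ℝ) (h1 : c ≠ c') (h2 : c ∉ S') (h3 : c' ∉ S) (h4 : Disjoint S S') :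
    starVec c S t ⬝ᵥ starVec c' S' t' = 0 := by
  rw [starVec_dot]
  have : ∑ s ∈ S, starVec c' S' t' s = 0 := by
    refine Finset.sum_eq_zero fun s hs => ?_
    have a : s ≠ c' := fun h => h3 (h ▸ hs)
    have b : s ∉ S' := Finset.disjoint_left.mp h4 hs
    simp [starVec, a, b]
  rw [this]
  simp [starVec, h1, h2]

open Matrix in
lemma star_self {n : ℕ} (G : SimpleGraph (Fin n)) (c : Fin n) (S : Finset (Fin n)) (k : ℕ)
    (hk : S.card = k) (hc : c ∉ S) (h1 : ∀ s ∈ S, G.Adj c s)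
    (h2 : ∀ s ∈ S, ∀ s' ∈ S, ¬ G.Adj s s') :
    0 < starVec c S (1 / √(k : ℝ)) ⬝ᵥ starVec c S (1 / √(k : ℝ)) ∧
    √(k : ℝ) * (starVec c S (1 / √(k : ℝ)) ⬝ᵥ starVec c S (1 / √(k : ℝ))) ≤
      starVec c S (1 / √(k : ℝ)) ⬝ᵥ (adjMat G *ᵥ starVec c S (1 / √(k : ℝ))) := by
  set t : ℝ := 1 / √(k : ℝ) with ht
  have e1 : starVec c S t ⬝ᵥ starVec c S t = 1 + t * (k * t) := by
    rw [starVec_dot]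
    have : ∀ s ∈ S, starVec c S t s = t := by
      intro s hs
      have : s ≠ c := fun h => hc (h ▸ hs)
      simp [starVec, hs, this]
    rw [Finset.sum_congr rfl this]
    simp [starVec, hc, hk]
  have e2 : starVec c S t ⬝ᵥ (adjMat G *ᵥ starVec c S t) = t * k + t * k := by
    rw [starVec_dot]
    simp only [mulVec_starVec]
    have a1 : ∑ s ∈ S, adjMat G c s = k := by
      rw [Finset.sum_congr rfl (fun s hs => show adjMat G c s = 1 by simp [adjMat, h1 s hs])]
      simp [hk]
    have a2 : ∑ s ∈ S, (adjMat G s c + t * ∑ s' ∈ S, adjMat G s s') = k := by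
      rw [Finset.sum_congr rfl (g := fun _ => (1 : ℝ))]
      · simp [hk]
      · intro s hs
        rw [Finset.sum_eq_zero fun s' hs' => show adjMat G s s' = 0 by simp [adjMat, h2 s hs s' hs']]
        simp [adjMat, (h1 s hs).symm]
    rw [a1, a2]
    simp [adjMat]
  rw [e1, e2]
  refine ⟨?_, ?_⟩
  · have : 0 ≤ t * (k * t) := by positivity
    linarith
  · rcases Nat.eq_zero_or_pos k with h | h
    · simp [h]
    · have hk' : (0 : ℝ) < √(k : ℝ) := Real.sqrt_pos.mpr (by exact_mod_cast h)
      have hsq : √(k : ℝ) * √(k : ℝ) = k := Real.mul_self_sqrt (by positivity)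
      have h3 : t * k = √(k : ℝ) := by rw [ht]; field_simp; rw [sq, hsq]
      have h4 : t * √(k : ℝ) = 1 := by rw [ht]; field_simp
      have h5 : t * (k * t) = 1 := by rw [← mul_assoc, h3, mul_comm, h4]
      rw [h5, h3]; linarith

/-- Graph on `Fin n` whose edges join each `i > 0` to its parent `p i`. -/
def parentGraph (n : ℕ) (p : ℕ → ℕ) (hp : ∀ i, 0 < i → p i < i) : SimpleGraph (Fin n) where
  Adj i j := (0 < i.val ∧ p i = j) ∨ (0 < j.val ∧ p j = i)
  symm := ⟨fun i j h => h.symm⟩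
  loopless := ⟨fun i h => by
    rcases h with ⟨h, h'⟩ | ⟨h, h'⟩ <;> have := hp _ h <;> omega⟩

lemma parentGraph_isTree (n : ℕ) (hn : 0 < n) (p : ℕ → ℕ) (hp : ∀ i, 0 < i → p i < i) :
    (parentGraph n p hp).IsTree := by
  have hreach : ∀ k (hk : k < n), (parentGraph n p hp).Reachable ⟨k, hk⟩ ⟨0, hn⟩ := by
    intro k
    induction k using Nat.strong_induction_on with
    | _ k ih =>
      intro hk
      rcases Nat.eq_zero_or_pos k with h | h
      · subst h; rfl
      · have hlt := hp k h
        refine SimpleGraph.Reachable.trans (SimpleGraph.Adj.reachable ?_)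
          (ih (p k) hlt (hlt.trans hk))
        exact Or.inl ⟨h, rfl⟩
  have hconn : (parentGraph n p hp).Connected := by
    have : Nonempty (Fin n) := ⟨⟨0, hn⟩⟩
    exact ⟨fun a b => (hreach a a.2).trans (hreach b b.2).symm⟩
  rw [SimpleGraph.isTree_iff_connected_and_card]
  refine ⟨hconn, le_antisymm ?_ hconn.card_vert_le_card_edgeSet_add_one⟩
  have hsub : (parentGraph n p hp).edgeSet ⊆
      ((Finset.univ.erase (⟨0, hn⟩ : Fin n)).image
        (fun i : Fin n => s(i, if h : 0 < i.val then ⟨p i, (hp i h).trans i.2⟩ else i)) :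
          Set (Sym2 (Fin n))) := by
    intro e
    induction e using Sym2.ind with
    | _ a b =>
      intro h
      rw [SimpleGraph.mem_edgeSet] at h
      simp only [Finset.coe_image, Set.mem_image, Finset.mem_coe, Finset.mem_erase,
        Finset.mem_univ, and_true]
      rcases h with ⟨h, h'⟩ | ⟨h, h'⟩
      · refine ⟨a, fun h0 => by simp [h0] at h, ?_⟩
        rw [dif_pos h]
        congr 2
      · refine ⟨b, fun h0 => by simp [h0] at h, ?_⟩
        rw [dif_pos h, Sym2.eq_swap]
        congr 2
  have h1 := Set.ncard_le_ncard hsub (Finset.finite_toSet _)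
  rw [Set.ncard_coe_finset] at h1
  have h3 := h1.trans Finset.card_image_le
  rw [Finset.card_erase_of_mem (Finset.mem_univ _), Finset.card_univ, Fintype.card_fin] at h3
  rw [← Nat.card_coe_set_eq] at h3
  rw [Nat.card_eq_fintype_card (α := Fin n), Fintype.card_fin]
  omega

lemma exists_tree (k1 k2 n : ℕ) (hk : k2 ≤ k1) (hn : n = k1 + k2 + 3) :
    ∃ T : SimpleGraph (Fin n), T.IsTree ∧ √(k1 : ℝ) ≤ lam 1 T ∧ √(k2 : ℝ) ≤ lam 2 T := by
  let p : ℕ → ℕ := fun i => if i = 1 then 0 else if i = 2 then 1 else if i < 3 + k1 then 0 else 2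
  have hp : ∀ i, 0 < i → p i < i := by
    intro i hi
    simp only [p]
    split_ifs <;> omega
  let T := parentGraph n p hp
  let c : Fin n := ⟨0, by omega⟩
  let d : Fin n := ⟨2, by omega⟩
  let S : Finset (Fin n) := Finset.univ.filter fun i => 3 ≤ i.val ∧ i.val < 3 + k1
  let S' : Finset (Fin n) := Finset.univ.filter fun i => 3 + k1 ≤ i.val
  have hS : S.card = k1 := by
    rw [← Finset.card_map Fin.valEmbedding]
    have : S.map Fin.valEmbedding = Finset.Ico 3 (3 + k1) := by
      ext x
      simp only [S, Finset.mem_map, Finset.mem_filter, Finset.mem_univ, true_and,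
        Fin.valEmbedding_apply, Finset.mem_Ico]
      exact ⟨fun ⟨a, h, e⟩ => e ▸ h, fun h => ⟨⟨x, by omega⟩, h, rfl⟩⟩
    rw [this]; simp
  have hS' : S'.card = k2 := by
    rw [← Finset.card_map Fin.valEmbedding]
    have : S'.map Fin.valEmbedding = Finset.Ico (3 + k1) n := by
      ext x
      simp only [S', Finset.mem_map, Finset.mem_filter, Finset.mem_univ, true_and,
        Fin.valEmbedding_apply, Finset.mem_Ico]
      exact ⟨fun ⟨a, h, e⟩ => by have := a.2; omega, fun h => ⟨⟨x, by omega⟩, h.1, rfl⟩⟩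
    rw [this]; simp; omega
  have mS : ∀ i, i ∈ S ↔ 3 ≤ i.val ∧ i.val < 3 + k1 := by simp [S]
  have mS' : ∀ i, i ∈ S' ↔ 3 + k1 ≤ i.val := by simp [S']
  have hadj : ∀ i j, T.Adj i j ↔ (0 < i.val ∧ p i = j) ∨ (0 < j.val ∧ p j = i) := fun i j => Iff.rfl
  have pS : ∀ i ∈ S, p i.val = 0 := by
    intro i hi
    rw [mS] at hi
    simp only [p]
    split_ifs <;> omega
  have pS' : ∀ i ∈ S', p i.val = 2 := by
    intro i hi
    rw [mS'] at hi
    simp only [p]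
    split_ifs <;> omega
  have p2 : p 2 = 1 := by simp [p]
  have u := star_self T c S k1 hS (by simp [mS, c])
    (by
      intro s hs
      rw [hadj, pS s hs]
      rw [mS] at hs
      right; exact ⟨by omega, rfl⟩)
    (by
      intro s hs s' hs'
      rw [hadj, pS s hs, pS s' hs']
      rw [mS] at hs hs'
      omega)
  have v := star_self T d S' k2 hS' (by simp [mS', d]; omega)
    (by
      intro s hs
      rw [hadj, pS' s hs]
      rw [mS'] at hs
      right; exact ⟨by omega, rfl⟩)
    (by
      intro s hs s' hs'
      rw [hadj, pS' s hs, pS' s' hs']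
      rw [mS'] at hs hs'
      omega)
  have n1 : ¬ T.Adj c d := by
    rw [hadj]; simp [c, d, p2]
  have n2 : ∀ s ∈ S', ¬ T.Adj c s := by
    intro s hs
    rw [hadj, pS' s hs]
    simp [c]
  have n3 : ∀ s ∈ S, ¬ T.Adj s d := by
    intro s hs
    rw [hadj, pS s hs]
    rw [mS] at hs
    simp only [d, p2]
    omega
  have n4 : ∀ s ∈ S, ∀ s' ∈ S', ¬ T.Adj s s' := by
    intro s hs s' hs'
    rw [hadj, pS s hs, pS' s' hs']
    rw [mS] at hs
    rw [mS'] at hs'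
    omega
  refine ⟨T, parentGraph_isTree n (by omega) p hp, lam1_ge (by omega) T _ _ u.1 u.2, ?_⟩
  refine lam2_ge (by omega) T _ _ _ u.1 v.1 ?_ ?_ ?_ ?_ v.2
  · refine star_orth c d S S' _ _ (by simp [c, d]) (by simp [mS', c]) (by simp [mS, d]) ?_
    rw [Finset.disjoint_left]
    intro a ha ha'
    rw [mS] at ha
    rw [mS'] at ha'
    omega
  · exact star_cross T c d S S' _ _ n1 n2 n3 n4
  · exact star_cross T d c S' S _ _ (fun h => n1 h.symm) (fun s hs h => n3 s hs h.symm)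
      (fun s hs h => n2 s hs h.symm) (fun s hs s' hs' h => n4 s' hs' s hs h.symm)
  · refine le_trans (mul_le_mul_of_nonneg_right ?_ u.1.le) u.2
    exact Real.sqrt_le_sqrt (by exact_mod_cast hk)
/-- Asymptotics of the normalized maximum of `α λ₁ + (1-α) λ₂` over trees on `n` vertices:
the limit of `Ψₙ(α)/√(n-1)` is `√(1/2)` for `α ≤ 1/2` and `√(α² + (1-α)²)` for `α > 1/2`. -/
theorem psi_asymptotics (α : ℝ) (hα0 : 0 ≤ α) (hα1 : α ≤ 1) :
    Filter.Tendsto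
      (fun n : ℕ =>
        (sSup {x : ℝ | ∃ T : SimpleGraph (Fin n), T.IsTree ∧
            x = α * lam 1 T + (1 - α) * lam 2 T}) / Real.sqrt ((n : ℝ) - 1))
      Filter.atTop
      (nhds (if α ≤ 1 / 2 then Real.sqrt (1 / 2)
             else Real.sqrt (α ^ 2 + (1 - α) ^ 2))) := by
  set L : ℝ := if α ≤ 1 / 2 then Real.sqrt (1 / 2) else Real.sqrt (α ^ 2 + (1 - α) ^ 2) with hL
  -- the proportion of leaves at the second star
  obtain ⟨c, hc0, hc1, hcL⟩ : ∃ c : ℝ, 0 ≤ c ∧ c ≤ 1 / 2 ∧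
      α * √(1 - c) + (1 - α) * √c = L := by
    by_cases h : α ≤ 1 / 2
    · refine ⟨1 / 2, by norm_num, le_rfl, ?_⟩
      rw [hL, if_pos h, show (1 : ℝ) - 1 / 2 = 1 / 2 by norm_num]
      ring
    · have hs : 0 < α ^ 2 + (1 - α) ^ 2 := by nlinarith
      refine ⟨(1 - α) ^ 2 / (α ^ 2 + (1 - α) ^ 2), by positivity, ?_, ?_⟩
      · rw [div_le_iff₀ hs]
        nlinarith
      · rw [hL, if_neg h]
        have e : 1 - (1 - α) ^ 2 / (α ^ 2 + (1 - α) ^ 2) = α ^ 2 / (α ^ 2 + (1 - α) ^ 2) := by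
          field_simp; ring
        rw [e, Real.sqrt_div (sq_nonneg _), Real.sqrt_div (sq_nonneg _), Real.sqrt_sq hα0,
          Real.sqrt_sq (by linarith)]
        have hq : 0 < √(α ^ 2 + (1 - α) ^ 2) := Real.sqrt_pos.mpr hs
        have hq2 : √(α ^ 2 + (1 - α) ^ 2) ^ 2 = α ^ 2 + (1 - α) ^ 2 := Real.sq_sqrt hs.le
        field_simp
        rw [hq2]
  -- upper bound
  have hub : ∀ n : ℕ, 4 ≤ n → ∀ T : SimpleGraph (Fin n), T.IsTree →
      α * lam 1 T + (1 - α) * lam 2 T ≤ L * √((n : ℝ) - 1) := by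
    intro n hn T hT
    have h1 := sq_add_sq_le hn T hT
    have h2 := lam2_le_lam1 (by omega) T
    have hn1 : (0 : ℝ) ≤ (n : ℝ) - 1 := by
      have : (4 : ℝ) ≤ n := by exact_mod_cast hn
      linarith
    set x := lam 1 T
    set y := lam 2 T
    by_cases h : α ≤ 1 / 2
    · rw [hL, if_pos h, ← Real.sqrt_mul (by norm_num)]
      refine le_trans (b := (x + y) / 2) (by nlinarith) (Real.le_sqrt_of_sq_le ?_)
      nlinarith [sq_nonneg (x - y)]
    · rw [hL, if_neg h, ← Real.sqrt_mul (by positivity)]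
      apply Real.le_sqrt_of_sq_le
      have : (α * x + (1 - α) * y) ^ 2 ≤ (α ^ 2 + (1 - α) ^ 2) * (x ^ 2 + y ^ 2) := by
        nlinarith [sq_nonneg (α * y - (1 - α) * x)]
      exact this.trans (mul_le_mul_of_nonneg_left h1 (by positivity))
  -- lower bound
  have hlb : ∀ n : ℕ, 4 ≤ n → ∃ T : SimpleGraph (Fin n), T.IsTree ∧
      α * √((1 - c) * ((n : ℝ) - 3)) + (1 - α) * √(c * ((n : ℝ) - 3) - 1) ≤
        α * lam 1 T + (1 - α) * lam 2 T := by
    intro n hn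
    obtain ⟨m, rfl⟩ : ∃ m, n = m + 3 := ⟨n - 3, by omega⟩
    have hm : ((m + 3 : ℕ) : ℝ) - 3 = m := by push_cast; ring
    rw [hm]
    have f1 : (⌊c * m⌋₊ : ℝ) ≤ c * m := Nat.floor_le (by positivity)
    have f2 : c * m < ⌊c * m⌋₊ + 1 := Nat.lt_floor_add_one _
    set k := ⌊c * m⌋₊
    have f3 : 2 * k ≤ m := by
      have : (2 : ℝ) * k ≤ m := by
        have : c * m ≤ 1 / 2 * m := mul_le_mul_of_nonneg_right hc1 (by positivity)
        linarith
      exact_mod_cast this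
    obtain ⟨T, hT, t1, t2⟩ := exists_tree (m - k) k (m + 3) (by omega) (by omega)
    refine ⟨T, hT, add_le_add (mul_le_mul_of_nonneg_left (le_trans ?_ t1) hα0)
      (mul_le_mul_of_nonneg_left (le_trans ?_ t2) (by linarith))⟩
    · apply Real.sqrt_le_sqrt
      rw [Nat.cast_sub (by omega)]
      linarith
    · apply Real.sqrt_le_sqrt
      linarith
  -- limit of the lower bound
  have hinv : Filter.Tendsto (fun n : ℕ => ((n : ℝ) - 1)⁻¹) Filter.atTop (nhds 0) := by
    apply Filter.Tendsto.inv_tendsto_atTop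
    exact Filter.tendsto_atTop_add_const_right _ (-1) tendsto_natCast_atTop_atTop
  have hlim : Filter.Tendsto (fun n : ℕ =>
      α * √((1 - c) * (1 - 2 * ((n : ℝ) - 1)⁻¹)) +
        (1 - α) * √(c * (1 - 2 * ((n : ℝ) - 1)⁻¹) - ((n : ℝ) - 1)⁻¹))
      Filter.atTop (nhds L) := by
    have hcont : Continuous (fun x : ℝ => α * √((1 - c) * (1 - 2 * x)) +
        (1 - α) * √(c * (1 - 2 * x) - x)) := by fun_prop
    have := (hcont.tendsto 0).comp hinv
    simpa [hcL, Function.comp_def] using this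
  refine tendsto_of_tendsto_of_tendsto_of_le_of_le' hlim tendsto_const_nhds ?_ ?_
  · filter_upwards [Filter.eventually_ge_atTop 4] with n hn
    have hn1 : (0 : ℝ) < (n : ℝ) - 1 := by
      have : (4 : ℝ) ≤ n := by exact_mod_cast hn
      linarith
    obtain ⟨T, hT, hle⟩ := hlb n hn
    rw [le_div_iff₀ (Real.sqrt_pos.mpr hn1)]
    refine le_trans ?_ (le_csSup ⟨L * √((n : ℝ) - 1), ?_⟩ ⟨T, hT, rfl⟩)
    · refine le_trans (le_of_eq ?_) hle
      rw [add_mul, mul_assoc, mul_assoc, ← Real.sqrt_mul' _ hn1.le, ← Real.sqrt_mul' _ hn1.le]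
      have e1 : (1 - c) * (1 - 2 * ((n : ℝ) - 1)⁻¹) * ((n : ℝ) - 1) = (1 - c) * ((n : ℝ) - 3) := by
        field_simp
        ring
      have e2 : (c * (1 - 2 * ((n : ℝ) - 1)⁻¹) - ((n : ℝ) - 1)⁻¹) * ((n : ℝ) - 1) =
          c * ((n : ℝ) - 3) - 1 := by
        field_simp
        ring
      rw [e1, e2]
    · rintro x ⟨T', hT', rfl⟩
      exact hub n hn T' hT'
  · filter_upwards [Filter.eventually_ge_atTop 4] with n hn
    have hn1 : (0 : ℝ) < (n : ℝ) - 1 := by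
      have : (4 : ℝ) ≤ n := by exact_mod_cast hn
      linarith
    rw [div_le_iff₀ (Real.sqrt_pos.mpr hn1)]
    obtain ⟨T, hT, hle⟩ := hlb n hn
    refine csSup_le ⟨_, T, hT, rfl⟩ ?_
    rintro x ⟨T', hT', rfl⟩
    exact hub n hn T' hT'
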